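/- The number of W_k-hesitating walks of length 2n from λ to μ equals the signed sum over permutations π of S_k of the number of Q_k-hesitating walks from λ to π(μ): w_k(λ, μ, 2n) = \sum_{π ∈ S_k} sgn(π) · q_k(λ, π(μ), 2n), where π(μ_1,…,μ_k) = (μ_{π(1)},…,μ_{π(k)}). -/

import Mathlib

/-- A hesitating walk of length `2n` from `lam` to `mu`, confined to the region
`R`, built from pairs of moves: stay then `+e_r`; `−e_r` then stay;
`+e_r` then `−e_s`. -/
def IsHesitatingWalkIn (k : ℕ) (R : (Fin k → ℤ) → Prop) (n : ℕ)
    (lam mu : Fin k → ℤ) (w : Fin (2*n+1) → Fin k → ℤ) : Prop :=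
  (∀ i, R (w i)) ∧
  (w ⟨0, by omega⟩ = lam) ∧ (w ⟨2*n, by omega⟩ = mu) ∧
  ∀ i, ∀ _ : i < n,
    (w ⟨2*i+1, by omega⟩ = w ⟨2*i, by omega⟩ ∧
      (∃ r, w ⟨2*i+2, by omega⟩ =
        Function.update (w ⟨2*i+1, by omega⟩) r (w ⟨2*i+1, by omega⟩ r + 1))) ∨
    ((∃ r, w ⟨2*i+1, by omega⟩ =
        Function.update (w ⟨2*i, by omega⟩) r (w ⟨2*i, by omega⟩ r - 1)) ∧
      w ⟨2*i+2, by omega⟩ = w ⟨2*i+1, by omega⟩) ∨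
    ((∃ r, w ⟨2*i+1, by omega⟩ =
        Function.update (w ⟨2*i, by omega⟩) r (w ⟨2*i, by omega⟩ r + 1)) ∧
      (∃ s, w ⟨2*i+2, by omega⟩ =
        Function.update (w ⟨2*i+1, by omega⟩) s (w ⟨2*i+1, by omega⟩ s - 1)))

namespace HesitatingWalk

variable {k n : ℕ}

/-- `y` is obtained from `x` by adding `ε` to a single coordinate. -/
def Shift (ε : ℤ) (x y : Fin k → ℤ) : Prop :=
  ∃ r, y = Function.update x r (x r + ε)

theorem Shift.comp_perm {ε : ℤ} {x y : Fin k → ℤ} (h : Shift ε x y) (σ : Equiv.Perm (Fin k)) :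
    Shift ε (x ∘ σ) (y ∘ σ) := by
  obtain ⟨r, rfl⟩ := h
  refine ⟨σ.symm r, ?_⟩
  rw [Function.update_comp_equiv]
  simp

theorem isHesitatingWalkIn_iff {R : (Fin k → ℤ) → Prop} {lam mu : Fin k → ℤ}
    {w : Fin (2 * n + 1) → Fin k → ℤ} :
    IsHesitatingWalkIn k R n lam mu w ↔
      (∀ i, R (w i)) ∧ w ⟨0, by omega⟩ = lam ∧ w ⟨2 * n, by omega⟩ = mu ∧
      ∀ i, ∀ _ : i < n,
        (w ⟨2 * i, by omega⟩ = w ⟨2 * i + 1, by omega⟩ ∧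
          Shift 1 (w ⟨2 * i + 1, by omega⟩) (w ⟨2 * i + 2, by omega⟩)) ∨
        (Shift (-1) (w ⟨2 * i, by omega⟩) (w ⟨2 * i + 1, by omega⟩) ∧
          w ⟨2 * i + 1, by omega⟩ = w ⟨2 * i + 2, by omega⟩) ∨
        (Shift 1 (w ⟨2 * i, by omega⟩) (w ⟨2 * i + 1, by omega⟩) ∧
          Shift (-1) (w ⟨2 * i + 1, by omega⟩) (w ⟨2 * i + 2, by omega⟩)) := by
  unfold IsHesitatingWalkIn Shift
  simp only [← sub_eq_add_neg]
  refine and_congr_right fun _ => and_congr_right fun _ => and_congr_right fun _ =>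
    forall_congr' fun i => forall_congr' fun hi => ?_
  rw [eq_comm (a := w ⟨2 * i + 1, _⟩) (b := w ⟨2 * i, _⟩),
    eq_comm (a := w ⟨2 * i + 2, _⟩) (b := w ⟨2 * i + 1, _⟩)]

theorem exists_succ_eq_update_of_isHesitatingWalkIn {R : (Fin k → ℤ) → Prop} {lam mu : Fin k → ℤ}
    {w : Fin (2 * n + 1) → Fin k → ℤ} (hw : IsHesitatingWalkIn k R n lam mu w)
    (j : ℕ) (hj : j < 2 * n) :
    ∃ r, ∃ ε : ℤ, |ε| ≤ 1 ∧ w ⟨j + 1, by omega⟩ =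
        Function.update (w ⟨j, by omega⟩) r (w ⟨j, by omega⟩ r + ε) := by
  have hstep := (isHesitatingWalkIn_iff.1 hw).2.2.2
  have heq : ∀ x y z t : Fin k → ℤ, ∀ δ, x = y → Shift δ z t →
      ∃ r, ∃ ε : ℤ, |ε| ≤ 1 ∧ y = Function.update x r (x r + ε) := by
    rintro x _ z t δ rfl ⟨r, -⟩
    exact ⟨r, 0, by simp, by simp⟩
  have hshift : ∀ x y : Fin k → ℤ, ∀ δ : ℤ, |δ| ≤ 1 → Shift δ x y →
      ∃ r, ∃ ε : ℤ, |ε| ≤ 1 ∧ y = Function.update x r (x r + ε) := by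
    rintro x y δ hδ ⟨r, h⟩
    exact ⟨r, δ, hδ, h⟩
  obtain ⟨i, rfl | rfl⟩ := Nat.even_or_odd' j
  · rcases hstep i (by omega) with ⟨h, h'⟩ | ⟨h, h'⟩ | ⟨h, h'⟩
    · exact heq _ _ _ _ _ h h'
    · exact hshift _ _ _ (by simp) h
    · exact hshift _ _ _ (by simp) h
  · rcases hstep i (by omega) with ⟨h, h'⟩ | ⟨h, h'⟩ | ⟨h, h'⟩
    · exact hshift _ _ _ (by simp) h'
    · exact heq _ _ _ _ _ h' h
    · exact hshift _ _ _ (by simp) h'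

theorem finite_setOf_isHesitatingWalkIn (R : (Fin k → ℤ) → Prop) (lam mu : Fin k → ℤ) :
    {w : Fin (2 * n + 1) → Fin k → ℤ | IsHesitatingWalkIn k R n lam mu w}.Finite := by
  refine (Set.Finite.pi' fun i : Fin (2 * n + 1) => Set.Finite.pi' fun a : Fin k =>
    Set.finite_Icc (lam a - (i : ℕ)) (lam a + (i : ℕ))).subset ?_
  rintro w hw ⟨j, hj⟩ a
  induction j with
  | zero =>
    rw [hw.2.1]
    simp
  | succ j ih =>
    have hj' := ih (by omega)
    obtain ⟨r, ε, hε, h⟩ := exists_succ_eq_update_of_isHesitatingWalkIn hw j (by omega)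
    rw [abs_le] at hε
    rw [h]
    simp only [Set.mem_Icc, Function.update_apply] at hj' ⊢
    push_cast
    split_ifs with har
    · subst har
      constructor <;> linarith
    · constructor <;> linarith

theorem strictAnti_of_injective {R : (Fin k → ℤ) → Prop} {lam mu : Fin k → ℤ}
    {w : Fin (2 * n + 1) → Fin k → ℤ} (hw : IsHesitatingWalkIn k R n lam mu w)
    (hlam : StrictAnti lam) (hinj : ∀ i, Function.Injective (w i)) (i : Fin (2 * n + 1)) :
    StrictAnti (w i) := by
  obtain ⟨j, hj⟩ := i
  induction j with
  | zero => rwa [hw.2.1]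
  | succ j ih =>
    intro a b hab
    have hlt := ih (by omega) hab
    have hne : w ⟨j + 1, hj⟩ a ≠ w ⟨j + 1, hj⟩ b := fun h => hab.ne (hinj _ h)
    obtain ⟨r, ε, hε, h⟩ := exists_succ_eq_update_of_isHesitatingWalkIn hw j (by omega)
    rw [abs_le] at hε
    rw [h] at hne ⊢
    simp only [Function.update_apply] at hne ⊢
    split_ifs at hne ⊢ with hb ha ha
    · exact absurd (ha.trans hb.symm) hab.ne
    all_goals subst_vars; omega

theorem isHesitatingWalkIn_weylChamber_iff {lam mu : Fin k → ℤ} {w : Fin (2 * n + 1) → Fin k → ℤ}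
    (hlam : StrictAnti lam) :
    IsHesitatingWalkIn k (fun x => (∀ a b : Fin k, a < b → x b < x a) ∧ ∀ a, 0 < x a)
        n lam mu w ↔
      IsHesitatingWalkIn k (fun x => ∀ a, 0 < x a) n lam mu w ∧
        ∀ i, Function.Injective (w i) := by
  constructor
  · rintro ⟨hR, h⟩
    exact ⟨⟨fun i => (hR i).2, h⟩,
      fun i => StrictAnti.injective fun a b hab => (hR i).1 a b hab⟩
  · rintro ⟨hw, hinj⟩
    exact ⟨fun i => ⟨fun a b hab => strictAnti_of_injective hw hlam hinj i hab, hw.1 i⟩, hw.2⟩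

theorem eq_one_of_strictAnti_comp {mu : Fin k → ℤ} {π : Equiv.Perm (Fin k)}
    (hmu : StrictAnti mu) (h : StrictAnti (mu ∘ π)) : π = 1 := by
  have hmono : StrictMono π := fun a b hab => hmu.lt_iff_gt.1 (h hab)
  have hid : (π : Fin k → Fin k) = id := (hmono.range_inj strictMono_id).1 (by simp)
  exact Equiv.ext fun a => congrFun hid a

/-- A transposition fixing `x`, whenever `x` has two equal coordinates. -/
noncomputable def stabilizingSwap (x : Fin k → ℤ) : Equiv.Perm (Fin k) :=
  Classical.epsilon fun σ => Equiv.Perm.sign σ = -1 ∧ σ * σ = 1 ∧ x ∘ σ = x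

theorem stabilizingSwap_spec {x : Fin k → ℤ} (hx : ¬ Function.Injective x) :
    Equiv.Perm.sign (stabilizingSwap x) = -1 ∧ stabilizingSwap x * stabilizingSwap x = 1 ∧
      x ∘ stabilizingSwap x = x := by
  refine Classical.epsilon_spec
    (p := fun σ : Equiv.Perm (Fin k) => Equiv.Perm.sign σ = -1 ∧ σ * σ = 1 ∧ x ∘ σ = x) ?_
  simp only [Function.Injective, not_forall] at hx
  obtain ⟨a, b, hab, hne⟩ := hx
  refine ⟨Equiv.swap a b, Equiv.Perm.sign_swap hne, Equiv.swap_mul_self a b, ?_⟩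
  rw [Equiv.comp_swap_eq_update, hab, Function.update_eq_self, ← hab, Function.update_eq_self]

/-- An index at which the walk meets a wall `x_a = x_b`, if there is one. -/
noncomputable def wallIndex (w : Fin (2 * n + 1) → Fin k → ℤ) : Fin (2 * n + 1) :=
  Classical.epsilon fun i => ¬ Function.Injective (w i)

theorem wallIndex_spec {w : Fin (2 * n + 1) → Fin k → ℤ}
    (hw : ¬ ∀ i, Function.Injective (w i)) : ¬ Function.Injective (w (wallIndex w)) :=
  Classical.epsilon_spec (p := fun i => ¬ Function.Injective (w i)) (not_forall.1 hw)

/-- The transposition by which the tail of `w` is reflected. -/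
noncomputable def wallSwap (w : Fin (2 * n + 1) → Fin k → ℤ) : Equiv.Perm (Fin k) :=
  stabilizingSwap (w (wallIndex w))

/-- Reflect the part of `w` after its chosen meeting point with a wall. -/
noncomputable def reflectTail (w : Fin (2 * n + 1) → Fin k → ℤ) : Fin (2 * n + 1) → Fin k → ℤ :=
  fun i => if i < wallIndex w then w i else w i ∘ wallSwap w

theorem injective_reflectTail_iff (w : Fin (2 * n + 1) → Fin k → ℤ) (i : Fin (2 * n + 1)) :
    Function.Injective (reflectTail w i) ↔ Function.Injective (w i) := by
  unfold reflectTail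
  split_ifs
  · rfl
  · exact (wallSwap w).injective_comp _

theorem wallIndex_reflectTail (w : Fin (2 * n + 1) → Fin k → ℤ) :
    wallIndex (reflectTail w) = wallIndex w := by
  simp only [wallIndex, injective_reflectTail_iff]

theorem comp_wallSwap {w : Fin (2 * n + 1) → Fin k → ℤ}
    (hw : ¬ ∀ i, Function.Injective (w i)) :
    w (wallIndex w) ∘ wallSwap w = w (wallIndex w) :=
  (stabilizingSwap_spec (wallIndex_spec hw)).2.2

theorem reflectTail_of_le {w : Fin (2 * n + 1) → Fin k → ℤ}
    (hw : ¬ ∀ i, Function.Injective (w i)) {i : Fin (2 * n + 1)} (hi : i ≤ wallIndex w) :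
    reflectTail w i = w i := by
  unfold reflectTail
  split_ifs with h
  · rfl
  · rw [le_antisymm hi (not_lt.1 h), comp_wallSwap hw]

theorem reflectTail_of_ge (w : Fin (2 * n + 1) → Fin k → ℤ) {i : Fin (2 * n + 1)}
    (hi : wallIndex w ≤ i) : reflectTail w i = w i ∘ wallSwap w :=
  if_neg hi.not_gt

theorem wallSwap_reflectTail {w : Fin (2 * n + 1) → Fin k → ℤ}
    (hw : ¬ ∀ i, Function.Injective (w i)) : wallSwap (reflectTail w) = wallSwap w := by
  unfold wallSwap
  rw [wallIndex_reflectTail, reflectTail_of_le hw le_rfl]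

theorem reflectTail_reflectTail {w : Fin (2 * n + 1) → Fin k → ℤ}
    (hw : ¬ ∀ i, Function.Injective (w i)) : reflectTail (reflectTail w) = w := by
  have hσ : wallSwap w * wallSwap w = 1 := (stabilizingSwap_spec (wallIndex_spec hw)).2.1
  have hw' : ¬ ∀ i, Function.Injective (reflectTail w i) := by
    simpa only [injective_reflectTail_iff] using hw
  funext i
  rcases le_total i (wallIndex w) with hi | hi
  · rw [reflectTail_of_le hw' (by rwa [wallIndex_reflectTail]), reflectTail_of_le hw hi]
  · rw [reflectTail_of_ge _ (by rwa [wallIndex_reflectTail]), reflectTail_of_ge w hi,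
      wallSwap_reflectTail hw, Function.comp_assoc, ← Equiv.Perm.coe_mul, hσ]
    rfl

theorem reflectTail_rel {w : Fin (2 * n + 1) → Fin k → ℤ}
    (hw : ¬ ∀ i, Function.Injective (w i)) {r : (Fin k → ℤ) → (Fin k → ℤ) → Prop}
    (hr : ∀ x y, r x y → ∀ σ : Equiv.Perm (Fin k), r (x ∘ σ) (y ∘ σ))
    {j : ℕ} {hj : j < 2 * n + 1} {hj' : j + 1 < 2 * n + 1}
    (h : r (w ⟨j, hj⟩) (w ⟨j + 1, hj'⟩)) :
    r (reflectTail w ⟨j, hj⟩) (reflectTail w ⟨j + 1, hj'⟩) := by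
  rcases lt_or_ge j (wallIndex w : ℕ) with hlt | hge
  · rwa [reflectTail_of_le hw (Fin.le_def.2 hlt.le), reflectTail_of_le hw (Fin.le_def.2 (Nat.succ_le_of_lt hlt))]
  · rw [reflectTail_of_ge w (Fin.le_def.2 hge),
      reflectTail_of_ge w (Fin.le_def.2 (hge.trans j.le_succ))]
    exact hr _ _ h _

theorem isHesitatingWalkIn_reflectTail {R : (Fin k → ℤ) → Prop}
    (hR : ∀ x, R x → ∀ σ : Equiv.Perm (Fin k), R (x ∘ σ)) {lam mu : Fin k → ℤ}
    {w : Fin (2 * n + 1) → Fin k → ℤ} (hw : ¬ ∀ i, Function.Injective (w i))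
    (h : IsHesitatingWalkIn k R n lam mu w) :
    IsHesitatingWalkIn k R n lam (mu ∘ wallSwap w) (reflectTail w) := by
  rw [isHesitatingWalkIn_iff] at h ⊢
  obtain ⟨hreg, hstart, hend, hstep⟩ := h
  have heq : ∀ x y : Fin k → ℤ, x = y → ∀ σ : Equiv.Perm (Fin k), x ∘ σ = y ∘ σ :=
    fun x y hxy σ => by rw [hxy]
  have hshift : ∀ ε, ∀ x y : Fin k → ℤ, Shift ε x y →
      ∀ σ : Equiv.Perm (Fin k), Shift ε (x ∘ σ) (y ∘ σ) := fun _ _ _ => Shift.comp_perm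
  refine ⟨fun i => ?_, ?_, ?_, fun i hi => ?_⟩
  · unfold reflectTail
    split_ifs
    · exact hreg i
    · exact hR _ (hreg i) _
  · rw [reflectTail_of_le hw (Fin.le_def.2 (Nat.zero_le _)), hstart]
  · rw [reflectTail_of_ge w (Fin.le_def.2 (Nat.lt_succ_iff.1 (wallIndex w).2)), hend]
  · rcases hstep i hi with ⟨h, h'⟩ | ⟨h, h'⟩ | ⟨h, h'⟩
    · exact .inl ⟨reflectTail_rel hw heq h, reflectTail_rel hw (hshift _) h'⟩
    · exact .inr (.inl ⟨reflectTail_rel hw (hshift _) h, reflectTail_rel hw heq h'⟩)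
    · exact .inr (.inr ⟨reflectTail_rel hw (hshift _) h, reflectTail_rel hw (hshift _) h'⟩)

end HesitatingWalk

/-- The reflection principle of Bousquet-Mélou and Xin: the number of
`W_k`-hesitating walks of length `2n` from `λ` to `μ` is the signed sum, over
permutations `π ∈ S_k`, of the numbers of `Q_k`-hesitating walks from `λ` to
`π(μ)`, where `Q_k` is the open positive orthant and `π(μ)ᵢ = μ_{π(i)}`. -/
theorem hesitating_reflection_principle (k n : ℕ) (lam mu : Fin k → ℤ)
    (hlam : (∀ a b : Fin k, a < b → lam b < lam a) ∧ ∀ a, 0 < lam a)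
    (hmu : (∀ a b : Fin k, a < b → mu b < mu a) ∧ ∀ a, 0 < mu a) :
    (Nat.card {w : Fin (2*n+1) → Fin k → ℤ //
        IsHesitatingWalkIn k
          (fun x => (∀ a b : Fin k, a < b → x b < x a) ∧ ∀ a, 0 < x a)
          n lam mu w} : ℤ) =
      ∑ π : Equiv.Perm (Fin k), (Equiv.Perm.sign π : ℤ) *
        (Nat.card {w : Fin (2*n+1) → Fin k → ℤ //
          IsHesitatingWalkIn k (fun x => ∀ a, 0 < x a) n lam (mu ∘ π) w} : ℤ) := by
  classical
  have hlam' : StrictAnti lam := fun a b hab => hlam.1 a b hab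
  have hmu' : StrictAnti mu := fun a b hab => hmu.1 a b hab
  let Q : Equiv.Perm (Fin k) → Finset (Fin (2 * n + 1) → Fin k → ℤ) := fun π =>
    (HesitatingWalk.finite_setOf_isHesitatingWalkIn (fun x => ∀ a, 0 < x a) lam
      (mu ∘ π)).toFinset
  have hQ : ∀ π w, w ∈ Q π ↔
      IsHesitatingWalkIn k (fun x => ∀ a, 0 < x a) n lam (mu ∘ π) w := fun π w => by simp [Q]
  have hQcard : ∀ π : Equiv.Perm (Fin k), Nat.card {w : Fin (2*n+1) → Fin k → ℤ //
      IsHesitatingWalkIn k (fun x => ∀ a, 0 < x a) n lam (mu ∘ π) w} = (Q π).card := fun π =>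
    Nat.subtype_card _ (hQ π)
  have hW : Nat.card {w : Fin (2*n+1) → Fin k → ℤ //
      IsHesitatingWalkIn k (fun x => (∀ a b : Fin k, a < b → x b < x a) ∧ ∀ a, 0 < x a)
        n lam mu w} = {w ∈ Q 1 | ∀ i, Function.Injective (w i)}.card :=
    Nat.subtype_card _ fun w => by
      rw [HesitatingWalk.isHesitatingWalkIn_weylChamber_iff hlam', Finset.mem_filter, hQ]
      rfl
  have hgood : ∀ π, π ≠ 1 → {w ∈ Q π | ∀ i, Function.Injective (w i)} = ∅ := fun π hπ => by
    refine Finset.filter_eq_empty_iff.2 fun w hw hinj => hπ ?_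
    rw [hQ] at hw
    have h := HesitatingWalk.strictAnti_of_injective hw hlam' hinj ⟨2 * n, by omega⟩
    rw [hw.2.2.1] at h
    exact HesitatingWalk.eq_one_of_strictAnti_comp hmu' h
  have hbad : ∑ π : Equiv.Perm (Fin k), (Equiv.Perm.sign π : ℤ) *
      ({w ∈ Q π | ¬ ∀ i, Function.Injective (w i)}.card : ℤ) = 0 := by
    have hsigma : ∑ π : Equiv.Perm (Fin k), (Equiv.Perm.sign π : ℤ) *
        ({w ∈ Q π | ¬ ∀ i, Function.Injective (w i)}.card : ℤ) =
        ∑ p ∈ Finset.univ.sigma fun π => {w ∈ Q π | ¬ ∀ i, Function.Injective (w i)},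
          (Equiv.Perm.sign p.1 : ℤ) := by
      rw [Finset.sum_sigma]
      exact Finset.sum_congr rfl fun π _ => by simp [mul_comm]
    rw [hsigma]
    have hsign : ∀ p ∈ Finset.univ.sigma fun π =>
        {w ∈ Q π | ¬ ∀ i, Function.Injective (w i)},
        Equiv.Perm.sign (p.1 * HesitatingWalk.wallSwap p.2) = -Equiv.Perm.sign p.1 := by
      intro p hp
      have hw := (Finset.mem_filter.1 (Finset.mem_sigma.1 hp).2).2
      rw [Equiv.Perm.sign_mul, HesitatingWalk.wallSwap,
        (HesitatingWalk.stabilizingSwap_spec (HesitatingWalk.wallIndex_spec hw)).1, mul_neg_one]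
    refine Finset.sum_involution
      (fun p _ => ⟨p.1 * HesitatingWalk.wallSwap p.2, HesitatingWalk.reflectTail p.2⟩)
      (fun p hp => ?_) (fun p hp _ heq => ?_) (fun p hp => ?_) (fun p hp => ?_)
    · rw [hsign p hp]
      simp
    · have h := hsign p hp
      exact units_ne_neg_self _ ((congrArg (fun q => Equiv.Perm.sign q.1) heq).symm.trans h)
    · have hw := Finset.mem_filter.1 (Finset.mem_sigma.1 hp).2
      refine Finset.mem_sigma.2 ⟨Finset.mem_univ _, Finset.mem_filter.2 ⟨?_, ?_⟩⟩
      · exact (hQ _ _).2 (HesitatingWalk.isHesitatingWalkIn_reflectTail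
          (fun x hx σ a => hx (σ a)) hw.2 ((hQ _ _).1 hw.1))
      · simpa only [HesitatingWalk.injective_reflectTail_iff] using hw.2
    · have hw := (Finset.mem_filter.1 (Finset.mem_sigma.1 hp).2).2
      have hσ := (HesitatingWalk.stabilizingSwap_spec (HesitatingWalk.wallIndex_spec hw)).2.1
      rw [← HesitatingWalk.wallSwap] at hσ
      simp only [HesitatingWalk.reflectTail_reflectTail hw,
        HesitatingWalk.wallSwap_reflectTail hw, mul_assoc, hσ, mul_one]
  calc _ = ({w ∈ Q 1 | ∀ i, Function.Injective (w i)}.card : ℤ) := by rw [hW]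
    _ = ∑ π : Equiv.Perm (Fin k), (Equiv.Perm.sign π : ℤ) *
          ({w ∈ Q π | ∀ i, Function.Injective (w i)}.card : ℤ) := by
        rw [Finset.sum_eq_single 1 (fun π _ hπ => by simp [hgood π hπ]) (by simp)]
        simp
    _ = ∑ π : Equiv.Perm (Fin k), (Equiv.Perm.sign π : ℤ) *
          ({w ∈ Q π | ∀ i, Function.Injective (w i)}.card : ℤ) +
        ∑ π : Equiv.Perm (Fin k), (Equiv.Perm.sign π : ℤ) *
          ({w ∈ Q π | ¬ ∀ i, Function.Injective (w i)}.card : ℤ) := by rw [hbad, add_zero]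
    _ = _ := by
        rw [← Finset.sum_add_distrib]
        refine Finset.sum_congr rfl fun π _ => ?_
        rw [hQcard, ← mul_add, ← Nat.cast_add, Finset.card_filter_add_card_filter_not]
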